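/- arXiv:1712.04207 — 3 statements merged into one kernel-verified Lean document; each statement's English description precedes it below -/
import Mathlib

section
/- Let h : (0, 1] → ℝ be a concave function such that h(r) → 0 as r → 0⁺. Then the following three statements are equivalent: (1) lim_{r→1⁻} (h(r) − h(1))/(r − 1) = h(1); (2) lim_{r→0⁺} h(r)/r = h(1); (3) h(r) = r · h(1) for every r ∈ (0, 1]. -/
open Filter Topology Set

/-- A concave function on `(0, 1]` that tends to `0` at `0⁺` satisfies `x * h r ≤ r * h x`
for `0 < x < r ≤ 1`, that is, `h r / r` is antitone. -/
theorem mul_le_mul_of_concave_of_tendsto_zero {h : ℝ → ℝ}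
    (hconc : ∀ r₁ ∈ Set.Ioc (0 : ℝ) 1, ∀ r₂ ∈ Set.Ioc (0 : ℝ) 1,
      ∀ s ∈ Set.Icc (0 : ℝ) 1,
        s * h r₁ + (1 - s) * h r₂ ≤ h (s * r₁ + (1 - s) * r₂))
    (hlim : Tendsto h (𝓝[>] (0 : ℝ)) (𝓝 0)) {x r : ℝ} (hx : 0 < x) (hxr : x < r)
    (hr : r ≤ 1) : x * h r ≤ r * h x := by
  have hid : Tendsto (fun t : ℝ => t) (𝓝[>] (0 : ℝ)) (𝓝 0) := nhdsWithin_le_nhds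
  have hl : Tendsto (fun t => (x - t) * h r + (r - x) * h t) (𝓝[>] (0 : ℝ))
      (𝓝 ((x - 0) * h r + (r - x) * 0)) :=
    ((hid.const_sub x).mul_const _).add (hlim.const_mul _)
  have hr' : Tendsto (fun t => (r - t) * h x) (𝓝[>] (0 : ℝ)) (𝓝 ((r - 0) * h x)) :=
    (hid.const_sub r).mul_const _
  have key := le_of_tendsto_of_tendsto hl hr' (by
    filter_upwards [Ioo_mem_nhdsGT hx] with t ht
    have hrt : 0 < r - t := by linarith [ht.2]
    have hc := hconc r ⟨by linarith, hr⟩ t ⟨ht.1, by linarith [ht.2]⟩ ((x - t) / (r - t))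
      ⟨div_nonneg (by linarith [ht.2]) hrt.le, (div_le_one hrt).2 (by linarith)⟩
    have hs : 1 - (x - t) / (r - t) = (r - x) / (r - t) := by field_simp; ring
    have hcomb : (x - t) / (r - t) * r + (r - x) / (r - t) * t = x := by field_simp; ring
    rw [hs, hcomb, div_mul_eq_mul_div, div_mul_eq_mul_div, ← add_div, div_le_iff₀ hrt] at hc
    linarith)
  simpa using key

/-- For a concave function on `(0, 1]`, the slopes of the chords ending at `1` are antitone. -/
theorem slope_one_le_of_concave {h : ℝ → ℝ}
    (hconc : ∀ r₁ ∈ Set.Ioc (0 : ℝ) 1, ∀ r₂ ∈ Set.Ioc (0 : ℝ) 1,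
      ∀ s ∈ Set.Icc (0 : ℝ) 1,
        s * h r₁ + (1 - s) * h r₂ ≤ h (s * r₁ + (1 - s) * r₂))
    {x r : ℝ} (hx : 0 < x) (hxr : x < r) (hr : r < 1) :
    (h r - h 1) / (r - 1) ≤ (h x - h 1) / (x - 1) := by
  have hx1 : 0 < 1 - x := by linarith
  have hc := hconc x ⟨hx, by linarith⟩ 1 ⟨one_pos, le_rfl⟩ ((1 - r) / (1 - x))
    ⟨div_nonneg (by linarith) hx1.le, (div_le_one hx1).2 (by linarith)⟩
  have hs : 1 - (1 - r) / (1 - x) = (r - x) / (1 - x) := by field_simp; ring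
  have hcomb : (1 - r) / (1 - x) * x + (r - x) / (1 - x) * 1 = r := by field_simp; ring
  rw [hs, hcomb, div_mul_eq_mul_div, div_mul_eq_mul_div, ← add_div, div_le_iff₀ hx1] at hc
  rw [← neg_div_neg_eq, ← neg_div_neg_eq (h x - h 1), neg_sub, neg_sub, neg_sub, neg_sub,
    div_le_div_iff₀ (by linarith) hx1]
  linarith

/-- for `h` concave on `(0,1]` with `h(r) → 0` as `r → 0⁺`, the following are
equivalent: (1) `lim_{r→1⁻} (h(r) - h(1))/(r - 1) = h(1)`; (2) `lim_{r→0⁺} h(r)/r = h(1)`;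
(3) `h(r) = r · h(1)` for all `r ∈ (0,1]`. -/
theorem concave_tfae (h : ℝ → ℝ)
    (hconc : ∀ r₁ ∈ Set.Ioc (0 : ℝ) 1, ∀ r₂ ∈ Set.Ioc (0 : ℝ) 1,
      ∀ s ∈ Set.Icc (0 : ℝ) 1,
        s * h r₁ + (1 - s) * h r₂ ≤ h (s * r₁ + (1 - s) * r₂))
    (hlim : Tendsto h (𝓝[Set.Ioc (0 : ℝ) 1] (0 : ℝ)) (𝓝 0)) :
    (Tendsto (fun r : ℝ => (h r - h 1) / (r - 1)) (𝓝[<] (1 : ℝ)) (𝓝 (h 1)) ↔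
      Tendsto (fun r : ℝ => h r / r) (𝓝[>] (0 : ℝ)) (𝓝 (h 1))) ∧
    (Tendsto (fun r : ℝ => h r / r) (𝓝[>] (0 : ℝ)) (𝓝 (h 1)) ↔
      ∀ r ∈ Set.Ioc (0 : ℝ) 1, h r = r * h 1) := by
  have hlim' : Tendsto h (𝓝[>] (0 : ℝ)) (𝓝 0) := by
    rwa [nhdsWithin_Ioc_eq_nhdsGT one_pos] at hlim
  have lower : ∀ x ∈ Set.Ioo (0 : ℝ) 1, x * h 1 ≤ h x := fun x hx => by
    simpa using mul_le_mul_of_concave_of_tendsto_zero hconc hlim' hx.1 hx.2 le_rfl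
  have linear_of_upper (hup : ∀ x ∈ Set.Ioo (0 : ℝ) 1, h x ≤ x * h 1) :
      ∀ r ∈ Set.Ioc (0 : ℝ) 1, h r = r * h 1 := fun r hr => by
    rcases hr.2.eq_or_lt with rfl | hr1
    · rw [one_mul]
    · exact le_antisymm (hup r ⟨hr.1, hr1⟩) (lower r ⟨hr.1, hr1⟩)
  have linear_iff_one : Tendsto (fun r : ℝ => (h r - h 1) / (r - 1)) (𝓝[<] (1 : ℝ)) (𝓝 (h 1)) ↔
      ∀ r ∈ Set.Ioc (0 : ℝ) 1, h r = r * h 1 := by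
    refine ⟨fun H => linear_of_upper fun x hx => ?_, fun H => ?_⟩
    · have hle : h 1 ≤ (h x - h 1) / (x - 1) := le_of_tendsto H (by
        filter_upwards [Ioo_mem_nhdsLT hx.2] with r hr
        exact slope_one_le_of_concave hconc hx.1 hr.1 hr.2)
      rw [le_div_iff_of_neg (by linarith [hx.2])] at hle
      linarith
    · refine tendsto_const_nhds.congr' ?_
      filter_upwards [Ioo_mem_nhdsLT one_pos] with r hr
      have hne : r - 1 ≠ 0 := by linarith [hr.2]
      rw [H r ⟨hr.1, hr.2.le⟩, eq_div_iff hne]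
      ring
  have linear_iff_zero : Tendsto (fun r : ℝ => h r / r) (𝓝[>] (0 : ℝ)) (𝓝 (h 1)) ↔
      ∀ r ∈ Set.Ioc (0 : ℝ) 1, h r = r * h 1 := by
    refine ⟨fun H => linear_of_upper fun x hx => ?_, fun H => ?_⟩
    · have hle : h x / x ≤ h 1 := ge_of_tendsto H (by
        filter_upwards [Ioo_mem_nhdsGT hx.1] with t ht
        rw [div_le_div_iff₀ hx.1 ht.1]
        linarith [mul_le_mul_of_concave_of_tendsto_zero hconc hlim' ht.1 ht.2 hx.2.le])
      rw [div_le_iff₀ hx.1] at hle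
      linarith
    · refine tendsto_const_nhds.congr' ?_
      filter_upwards [Ioo_mem_nhdsGT one_pos] with r hr
      rw [H r ⟨hr.1, hr.2.le⟩, mul_div_cancel_left₀ _ hr.1.ne']
  exact ⟨linear_iff_one.trans linear_iff_zero.symm, linear_iff_zero⟩
end

section
/- Let z₀ ∈ ℂ, ρ > 0, and let f be a holomorphic function on the open ball B(z₀, ρ) ⊆ ℂ with f(z₀) = 1. Then ∫_{B(z₀, ρ)} |f|² dλ ≥ π ρ², where λ is the Lebesgue (area) measure on ℂ; moreover, equality ∫_{B(z₀, ρ)} |f|² dλ = π ρ² holds if and only if f is identically equal to 1 on B(z₀, ρ). -/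
open MeasureTheory Metric
open scoped ENNReal NNReal

/-- Lebesgue measure on `ℂ` is invariant under rotations about the origin. -/
theorem measurePreserving_circleMap_mul (θ : ℝ) :
    MeasurePreserving (fun w : ℂ => circleMap 0 1 θ * w) := by
  have h := (rotation (Circle.exp θ)).measurePreserving
  have e : (rotation (Circle.exp θ) : ℂ → ℂ) = fun w => circleMap 0 1 θ * w := by
    ext w
    simp [rotation_apply, circleMap]
  rwa [e] at h

/-- The mean of an integrable function over a family of rotations has the same integral as the
function itself. -/
theorem integral_intervalIntegral_circleMap_mul {g : ℂ → ℂ} (hm : StronglyMeasurable g)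
    (hg : Integrable g) :
    ∫ w : ℂ, ∫ θ in (0 : ℝ)..2 * Real.pi, g (circleMap 0 1 θ * w)
      = (2 * Real.pi) • ∫ w : ℂ, g w := by
  have key : ∀ {h : ℂ → ℂ}, StronglyMeasurable h → ∀ θ : ℝ,
      ∫ w : ℂ, h (circleMap 0 1 θ * w) = ∫ w : ℂ, h w := by
    intro h hh θ
    have mp := measurePreserving_circleMap_mul θ
    conv_rhs => rw [← mp.map_eq]
    exact (integral_map_of_stronglyMeasurable mp.measurable hh).symm
  have keyn : ∀ θ : ℝ, ∫ w : ℂ, ‖g (circleMap 0 1 θ * w)‖ = ∫ w : ℂ, ‖g w‖ := by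
    intro θ
    have mp := measurePreserving_circleMap_mul θ
    conv_rhs => rw [← mp.map_eq]
    exact (integral_map_of_stronglyMeasurable mp.measurable hm.norm).symm
  have hint : Integrable (Function.uncurry fun (w : ℂ) (θ : ℝ) => g (circleMap 0 1 θ * w))
      (volume.prod (volume.restrict (Set.Ioc 0 (2 * Real.pi)))) := by
    have hmeas : Measurable fun p : ℂ × ℝ => circleMap 0 1 p.2 * p.1 := by
      apply Continuous.measurable
      fun_prop
    refine (integrable_prod_iff' (hm.comp_measurable hmeas).aestronglyMeasurable).2 ⟨?_, ?_⟩
    · exact .of_forall fun θ => (measurePreserving_circleMap_mul θ).integrable_comp_of_integrable hg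
    · exact (integrable_const _).congr (.of_forall fun θ => (keyn θ).symm)
  simp only [intervalIntegral.integral_of_le Real.two_pi_pos.le]
  rw [integral_integral_swap hint]
  simp [key hm, Real.pi_pos.le]

/-- The area **mean value property** for integrable holomorphic functions on a disc. -/
theorem setIntegral_ball_eq_of_differentiableOn {z₀ : ℂ} {ρ : ℝ} {f : ℂ → ℂ}
    (hf : DifferentiableOn ℂ f (ball z₀ ρ)) (hi : IntegrableOn f (ball z₀ ρ)) :
    ∫ z in ball z₀ ρ, f z = (volume.real (ball z₀ ρ)) • f z₀ := by
  classical
  set F : ℂ → ℂ := (ball z₀ ρ).indicator f with hF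
  have hFm : Measurable F := by
    rw [hF, ← Set.piecewise_eq_indicator]
    exact hf.continuousOn.measurable_piecewise continuousOn_const measurableSet_ball
  have hFi : Integrable F := hi.integrable_indicator measurableSet_ball
  set g : ℂ → ℂ := fun w => F (z₀ + w) with hg
  have hgm : StronglyMeasurable g := (hFm.comp (measurable_const_add z₀)).stronglyMeasurable
  have hgi : Integrable g := hFi.comp_add_left z₀
  have hmean : ∀ w : ℂ, ∫ θ in (0 : ℝ)..2 * Real.pi, g (circleMap 0 1 θ * w)
      = (ball (0 : ℂ) ρ).indicator (fun _ => (2 * Real.pi) • f z₀) w := by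
    intro w
    by_cases hw : w ∈ ball (0 : ℂ) ρ
    · have hw' : ‖w‖ < ρ := by simpa using hw
      have hmaps : ∀ u ∈ closedBall (0 : ℂ) 1, z₀ + u * w ∈ ball z₀ ρ := by
        intro u hu
        have hu' : ‖u‖ ≤ 1 := by simpa using hu
        simp only [mem_ball, dist_self_add_left, norm_mul]
        nlinarith [norm_nonneg w]
      have hd : DiffContOnCl ℂ (fun u => f (z₀ + u * w)) (ball (0 : ℂ) |1|) := by
        refine DifferentiableOn.diffContOnCl ?_
        rw [abs_one, closure_ball _ one_ne_zero]
        exact hf.comp (t := ball z₀ ρ) (by fun_prop) hmaps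
      have h := hd.circleAverage
      rw [Real.circleAverage_def, inv_smul_eq_iff₀ Real.two_pi_pos.ne'] at h
      rw [Set.indicator_of_mem hw]
      simp only [zero_mul, add_zero] at h
      rw [← h]
      refine intervalIntegral.integral_congr fun θ _ => ?_
      exact Set.indicator_of_mem (hmaps _ (by simp)) f
    · have hw' : ρ ≤ ‖w‖ := by simpa using hw
      rw [Set.indicator_of_notMem hw]
      have : ∀ θ : ℝ, g (circleMap 0 1 θ * w) = 0 := fun θ =>
        Set.indicator_of_notMem (by simpa using hw') f
      simp [this]
  have h := integral_intervalIntegral_circleMap_mul hgm hgi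
  simp only [hmean] at h
  rw [integral_indicator measurableSet_ball, setIntegral_const, smul_comm] at h
  have h' := smul_right_injective ℂ Real.two_pi_pos.ne' h
  rw [hg, integral_add_left_eq_self F z₀, hF, integral_indicator measurableSet_ball] at h'
  rw [← h']
  simp [Measure.real, Complex.volume_ball]

/-- A square integrable holomorphic function `f` on a disc with `f z₀ = 1` at the center satisfies
`∫ ‖f‖² = area + ∫ ‖f - 1‖²`. -/
theorem setIntegral_ball_norm_sq_eq {z₀ : ℂ} {ρ : ℝ} {f : ℂ → ℂ}
    (hf : DifferentiableOn ℂ f (ball z₀ ρ)) (hf1 : f z₀ = 1)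
    (h2 : MemLp f 2 (volume.restrict (ball z₀ ρ))) :
    ∫ z in ball z₀ ρ, ‖f z‖ ^ 2
      = volume.real (ball z₀ ρ) + ∫ z in ball z₀ ρ, ‖f z - 1‖ ^ 2 := by
  have : IsFiniteMeasure (volume.restrict (ball z₀ ρ)) :=
    isFiniteMeasure_restrict.2 measure_ball_lt_top.ne
  have hi : Integrable f (volume.restrict (ball z₀ ρ)) := h2.integrable (by norm_num)
  have hsq : Integrable (fun z => ‖f z‖ ^ 2) (volume.restrict (ball z₀ ρ)) :=
    (memLp_two_iff_integrable_sq_norm h2.1).1 h2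
  have hre : ∫ z in ball z₀ ρ, (f z).re = volume.real (ball z₀ ρ) := by
    have h := setIntegral_ball_eq_of_differentiableOn hf hi
    have h3 := integral_re hi
    simp only [RCLike.re_to_complex] at h3
    rw [h3, h, hf1]
    simp
  have hpt : ∀ z, ‖f z - 1‖ ^ 2 = ‖f z‖ ^ 2 - 2 * (f z).re + 1 := by
    intro z
    rw [← Complex.normSq_eq_norm_sq, ← Complex.normSq_eq_norm_sq, Complex.normSq_apply,
      Complex.normSq_apply]
    simp only [Complex.sub_re, Complex.sub_im, Complex.one_re, Complex.one_im]
    ring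
  have hire : Integrable (fun z => 2 * (f z).re) (volume.restrict (ball z₀ ρ)) :=
    hi.re.const_mul 2
  simp only [hpt]
  have hsum : ∫ z in ball z₀ ρ, (‖f z‖ ^ 2 - 2 * (f z).re + 1)
      = (∫ z in ball z₀ ρ, (‖f z‖ ^ 2 - 2 * (f z).re)) + ∫ _ in ball z₀ ρ, (1 : ℝ) :=
    integral_add (hsq.sub hire) (integrable_const _)
  rw [hsum, integral_sub hsq hire, integral_const_mul, hre]
  simp
  ring

/-- for `f` holomorphic on the disc `B(z₀, ρ)` with `f z₀ = 1`, one has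
`∫_{B(z₀,ρ)} |f|² dλ ≥ π ρ²`, with equality if and only if `f ≡ 1` on the disc. -/
theorem disc_minimal_integral (z₀ : ℂ) (ρ : ℝ) (hρ : 0 < ρ) (f : ℂ → ℂ)
    (hf : DifferentiableOn ℂ f (ball z₀ ρ)) (hf1 : f z₀ = 1) :
    ENNReal.ofReal (Real.pi * ρ ^ 2) ≤
      (∫⁻ z in ball z₀ ρ, (‖f z‖₊ : ℝ≥0∞) ^ 2) ∧
    ((∫⁻ z in ball z₀ ρ, (‖f z‖₊ : ℝ≥0∞) ^ 2) = ENNReal.ofReal (Real.pi * ρ ^ 2) ↔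
      ∀ z ∈ ball z₀ ρ, f z = 1) := by
  have hvol : volume (ball z₀ ρ) = ENNReal.ofReal (Real.pi * ρ ^ 2) := by
    rw [Complex.volume_ball, mul_comm, ENNReal.ofReal_mul Real.pi_pos.le,
      ENNReal.ofReal_pow hρ.le, ← NNReal.coe_real_pi, ENNReal.ofReal_coe_nnreal]
  have hvr : volume.real (ball z₀ ρ) = Real.pi * ρ ^ 2 := by
    rw [Measure.real, hvol, ENNReal.toReal_ofReal (by positivity)]
  have hback : (∀ z ∈ ball z₀ ρ, f z = 1) →
      (∫⁻ z in ball z₀ ρ, (‖f z‖₊ : ℝ≥0∞) ^ 2) = ENNReal.ofReal (Real.pi * ρ ^ 2) := by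
    intro h
    rw [setLIntegral_congr_fun (g := fun _ => 1) measurableSet_ball
      (fun z hz => by simp [h z hz]), setLIntegral_one, hvol]
  have hfm : AEStronglyMeasurable f (volume.restrict (ball z₀ ρ)) :=
    hf.continuousOn.aestronglyMeasurable measurableSet_ball
  have hlin : ∀ z, (‖f z‖₊ : ℝ≥0∞) ^ 2 = ENNReal.ofReal (‖f z‖ ^ 2) := by
    intro z
    rw [ENNReal.ofReal_pow (norm_nonneg _), ofReal_norm, enorm_eq_nnnorm]
  by_cases htop : (∫⁻ z in ball z₀ ρ, (‖f z‖₊ : ℝ≥0∞) ^ 2) = ∞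
  · exact ⟨htop ▸ le_top, fun h => absurd (htop.symm.trans h) ENNReal.ofReal_ne_top.symm, hback⟩
  have hsq : Integrable (fun z => ‖f z‖ ^ 2) (volume.restrict (ball z₀ ρ)) := by
    refine (lintegral_ofReal_ne_top_iff_integrable (hfm.norm.pow 2)
      (.of_forall fun z => sq_nonneg ‖f z‖)).1 ?_
    simpa only [hlin, Pi.pow_apply] using htop
  have h2 := (memLp_two_iff_integrable_sq_norm hfm).2 hsq
  have hkey := setIntegral_ball_norm_sq_eq hf hf1 h2
  rw [hvr] at hkey
  have hnn : 0 ≤ ∫ z in ball z₀ ρ, ‖f z - 1‖ ^ 2 := integral_nonneg fun z => sq_nonneg _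
  have hL : (∫⁻ z in ball z₀ ρ, (‖f z‖₊ : ℝ≥0∞) ^ 2)
      = ENNReal.ofReal (Real.pi * ρ ^ 2 + ∫ z in ball z₀ ρ, ‖f z - 1‖ ^ 2) := by
    simp only [hlin]
    rw [← hkey, ofReal_integral_eq_lintegral_ofReal hsq (.of_forall fun z => sq_nonneg ‖f z‖)]
  refine ⟨hL ▸ ENNReal.ofReal_le_ofReal (by linarith), fun h => ?_, hback⟩
  rw [hL, ENNReal.ofReal_eq_ofReal_iff (by positivity) (by positivity)] at h
  have hzero : ∫ z in ball z₀ ρ, ‖f z - 1‖ ^ 2 = 0 := by linarith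
  have : IsFiniteMeasure (volume.restrict (ball z₀ ρ)) :=
    isFiniteMeasure_restrict.2 measure_ball_lt_top.ne
  have hint : Integrable (fun z => ‖f z - 1‖ ^ 2) (volume.restrict (ball z₀ ρ)) :=
    (memLp_two_iff_integrable_sq_norm (hfm.sub aestronglyMeasurable_const)).1
      (h2.sub (memLp_const 1))
  have hae := (integral_eq_zero_iff_of_nonneg (fun z => sq_nonneg ‖f z - 1‖) hint).1 hzero
  have hae1 : f =ᵐ[volume.restrict (ball z₀ ρ)] fun _ => 1 := by
    filter_upwards [hae] with z hz
    simpa [sub_eq_zero] using hz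
  exact Measure.eqOn_open_of_ae_eq hae1 isOpen_ball hf.continuousOn continuousOn_const
end

section
/- Let U ⊆ ℂ be an open set invariant under complex conjugation (z ∈ U implies conj(z) ∈ U). Let u be a real-valued function that is harmonic on U⁺ := U ∩ {z : Im z > 0} and continuous on U ∩ {z : Im z ≥ 0}, with u(x) = 0 for every x ∈ U ∩ ℝ. Then the function ũ : U → ℝ defined by ũ(z) = u(z) when Im z ≥ 0 and ũ(z) = −u(conj(z)) when Im z < 0 is harmonic on all of U. -/
open Filter Topology Set

/-- A real-valued function on (an open subset of) `ℂ ≅ ℝ²` is harmonic on `s` if it is `C²`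
there and its Laplacian vanishes at every point of `s`. -/
def HarmonicOnC (u : ℂ → ℝ) (s : Set ℂ) : Prop :=
  ContDiffOn ℝ 2 u s ∧
    ∀ z ∈ s,
      fderiv ℝ (fun y => fderiv ℝ u y 1) z 1 +
        fderiv ℝ (fun y => fderiv ℝ u y Complex.I) z Complex.I = 0

open InnerProductSpace Metric ComplexConjugate

/-- For a `C²` function on the plane, the Laplacian is the sum of the iterated partials. -/
lemma ContDiffAt.laplacian_complex_eq_fderiv_fderiv {u : ℂ → ℝ} {z : ℂ} (h : ContDiffAt ℝ 2 u z) :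
    Laplacian.laplacian u z = fderiv ℝ (fun y => fderiv ℝ u y 1) z 1 +
        fderiv ℝ (fun y => fderiv ℝ u y Complex.I) z Complex.I := by
  have hd : DifferentiableAt ℝ (fderiv ℝ u) z :=
    (h.fderiv_right (m := 1) (by norm_num)).differentiableAt (by norm_num)
  rw [laplacian_eq_iteratedFDeriv_complexPlane]
  simp [iteratedFDeriv_two_apply, fderiv_clm_apply hd]

lemma harmonicOnC_iff_harmonicOnNhd {u : ℂ → ℝ} {s : Set ℂ} (hs : IsOpen s) :
    HarmonicOnC u s ↔ HarmonicOnNhd u s := by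
  refine ⟨fun h z hz => ?_, fun h => ⟨h.contDiffOn, fun z hz => ?_⟩⟩
  · refine ⟨h.1.contDiffAt (hs.mem_nhds hz), ?_⟩
    filter_upwards [hs.mem_nhds hz] with y hy
    rw [(h.1.contDiffAt (hs.mem_nhds hy)).laplacian_complex_eq_fderiv_fderiv]
    exact h.2 y hy
  · rw [← (h z hz).1.laplacian_complex_eq_fderiv_fderiv]
    exact (h z hz).2.self_of_nhds

lemma InnerProductSpace.HarmonicAt.exists_analyticAt_re_eventuallyEq {f : ℂ → ℝ} {z : ℂ}
    (h : HarmonicAt f z) : ∃ F : ℂ → ℂ, AnalyticAt ℂ F z ∧ (fun w => (F w).re) =ᶠ[𝓝 z] f := by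
  obtain ⟨r, hr, hball⟩ := isOpen_iff.1 (isOpen_setOfPred_harmonicAt f) z h
  obtain ⟨F, hF, hFf⟩ := HarmonicOnNhd.exists_analyticOnNhd_ball_re_eq (f := f) (fun y hy => hball hy)
  exact ⟨F, hF z (mem_ball_self hr), hFf.eventuallyEq_of_mem (ball_mem_nhds z hr)⟩

lemma AnalyticAt.conj_conj {F : ℂ → ℂ} {z : ℂ} (h : AnalyticAt ℂ F (conj z)) :
    AnalyticAt ℂ (conj ∘ F ∘ conj) z := by
  rw [Complex.analyticAt_iff_eventually_differentiableAt] at h ⊢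
  filter_upwards [(Complex.continuous_conj.tendsto z).eventually h] with w hw
  simpa using hw.conj_conj

lemma InnerProductSpace.HarmonicAt.comp_conj {f : ℂ → ℝ} {z : ℂ} (h : HarmonicAt f (conj z)) :
    HarmonicAt (f ∘ conj) z := by
  obtain ⟨F, hF, hFf⟩ := h.exists_analyticAt_re_eventuallyEq
  refine (harmonicAt_congr_nhds ?_).1 hF.conj_conj.harmonicAt_re
  filter_upwards [(Complex.continuous_conj.tendsto z).eventually hFf] with w hw
  simpa using hw

/-- **Maximum principle**: near a local maximum, a harmonic function is constant. -/
lemma InnerProductSpace.HarmonicAt.eventually_eq_of_isLocalMax {f : ℂ → ℝ} {z : ℂ}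
    (h : HarmonicAt f z) (hmax : IsLocalMax f z) : ∀ᶠ w in 𝓝 z, f w = f z := by
  obtain ⟨F, hF, hFf⟩ := h.exists_analyticAt_re_eventuallyEq
  have hz := hFf.self_of_nhds
  have key := Complex.norm_eventually_eq_of_isLocalMax (f := fun w => Complex.exp (F w)) (c := z)
    (hF.eventually_analyticAt.mono fun w hw => hw.differentiableAt.cexp) (by
      filter_upwards [hFf, hmax] with w hw hle
      simp only [Function.comp_apply, Complex.norm_exp, Real.exp_le_exp]
      linarith)
  filter_upwards [key, hFf] with w hw hwf
  simp only [Complex.norm_exp, Real.exp_eq_exp] at hw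
  linarith

/-- A compactly supported continuous function that is harmonic wherever it is positive
is nowhere positive. -/
lemma nonpos_of_harmonicAt_of_pos {D : ℂ → ℝ} (hc : Continuous D) (hs : HasCompactSupport D)
    (hD : ∀ z, 0 < D z → HarmonicAt D z) (z : ℂ) : D z ≤ 0 := by
  by_contra! hz
  obtain ⟨m, hm⟩ := hc.exists_forall_ge_of_hasCompactSupport hs
  have hpos : 0 < D m := hz.trans_le (hm z)
  have hclopen : IsClopen {w | D w = D m} := by
    refine ⟨isClosed_eq hc continuous_const, isOpen_iff_mem_nhds.2 fun w hw => ?_⟩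
    have hw' : D w = D m := hw
    have := (hD w (hw' ▸ hpos)).eventually_eq_of_isLocalMax (.of_forall fun y => hw' ▸ hm y)
    filter_upwards [this] with y hy using hy.trans hw'
  have huniv := hclopen.eq_univ ⟨m, rfl⟩
  refine hs.isCompact.ne_univ (eq_univ_of_forall fun w => subset_tsupport D ?_)
  have hw : w ∈ {w | D w = D m} := huniv ▸ mem_univ w
  rw [mem_ofPred_eq] at hw
  exact (hw ▸ hpos).ne'

lemma eq_zero_of_harmonicAt_of_ne_zero {D : ℂ → ℝ} (hc : Continuous D) (hs : HasCompactSupport D)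
    (hD : ∀ z, D z ≠ 0 → HarmonicAt D z) (z : ℂ) : D z = 0 := by
  refine le_antisymm (nonpos_of_harmonicAt_of_pos hc hs (fun w hw => hD w hw.ne') z) ?_
  have := nonpos_of_harmonicAt_of_pos hc.neg hs.neg
    (fun w hw => (hD w (by simpa using hw.ne)).neg) z
  simpa using this

lemma continuousOn_poissonKernel_sphere {c w : ℂ} {R : ℝ} (hw : w ∈ ball c R) :
    ContinuousOn (poissonKernel c w) (sphere c R) := by
  have hR : 0 < R := pos_of_mem_ball hw
  rw [poissonKernel_eq_re_herglotzRieszKernel]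
  have := continuousOn_herglotzRieszKernel_sphere hw
  rw [abs_of_pos hR] at this
  exact Complex.continuous_re.comp_continuousOn this

lemma circleAverage_poissonKernel {c w : ℂ} {R : ℝ} (hw : w ∈ ball c R) :
    Real.circleAverage (poissonKernel c w) c R = 1 := by
  have := (harmonicContOnCl_const (E := ℂ) (c := (1 : ℝ))
    (s := ball c R)).circleAverage_poissonKernel_smul hw
  convert this using 2
  ext z
  simp

lemma poissonKernel_nonneg {c w ζ : ℂ} {R : ℝ} (hw : w ∈ ball c R) (hζ : ζ ∈ sphere c R) :
    0 ≤ poissonKernel c w ζ := by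
  rw [poissonKernel_def]
  rw [mem_ball_iff_norm] at hw
  rw [mem_sphere_iff_norm] at hζ
  have : ‖w - c‖ ^ 2 ≤ ‖ζ - c‖ ^ 2 := by rw [hζ]; gcongr
  exact div_nonneg (by linarith) (by positivity)

/-- Poisson integrals of continuous functions attain their boundary values. -/
lemma tendsto_circleAverage_poissonKernel_mul {g : ℂ → ℝ} {c ζ₀ : ℂ} {R : ℝ}
    (hg : ContinuousOn g (sphere c R)) (hζ₀ : ζ₀ ∈ sphere c R) :
    Tendsto (fun w => Real.circleAverage (fun ζ => poissonKernel c w ζ * g ζ) c R)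
      (𝓝[ball c R] ζ₀) (𝓝 (g ζ₀)) := by
  rcases le_or_gt R 0 with hR | hR
  · simp [ball_eq_empty.2 hR]
  obtain ⟨M, hM⟩ := (isCompact_sphere c R).exists_bound_of_continuousOn hg
  have hM0 : 0 ≤ M := (norm_nonneg _).trans (hM ζ₀ hζ₀)
  rw [Metric.tendsto_nhds]
  intro ε hε
  obtain ⟨δ, hδ, hgδ⟩ := Metric.continuousOn_iff.1 hg ζ₀ hζ₀ (ε / 2) (half_pos hε)
  have hlim : Tendsto (fun w : ℂ => 2 * M * ((R ^ 2 - ‖w - c‖ ^ 2) / (δ / 2) ^ 2))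
      (𝓝[ball c R] ζ₀) (𝓝 0) := by
    have hcont : Continuous (fun w : ℂ => 2 * M * ((R ^ 2 - ‖w - c‖ ^ 2) / (δ / 2) ^ 2)) := by
      fun_prop
    have := (hcont.tendsto ζ₀).mono_left (nhdsWithin_le_nhds (s := ball c R))
    simpa [mem_sphere_iff_norm.1 hζ₀] using this
  filter_upwards [self_mem_nhdsWithin, nhdsWithin_le_nhds (ball_mem_nhds ζ₀ (half_pos hδ)),
    hlim.eventually_lt_const (half_pos hε)] with w hw hwδ hsmall
  have hP := continuousOn_poissonKernel_sphere hw
  have hPi : CircleIntegrable (poissonKernel c w) c R := hP.circleIntegrable hR.le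
  have hdiff : Real.circleAverage (fun ζ => poissonKernel c w ζ * g ζ) c R - g ζ₀ =
      Real.circleAverage (fun ζ => poissonKernel c w ζ * (g ζ - g ζ₀)) c R := by
    have hconst : Real.circleAverage (fun ζ => g ζ₀ • poissonKernel c w ζ) c R = g ζ₀ := by
      rw [Real.circleAverage_fun_smul, circleAverage_poissonKernel hw, smul_eq_mul, mul_one]
    conv_lhs => rw [← hconst]
    rw [← Real.circleAverage_fun_sub (f₁ := fun ζ => poissonKernel c w ζ * g ζ)
      (f₂ := fun ζ => g ζ₀ • poissonKernel c w ζ) ((hP.mul hg).circleIntegrable hR.le)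
      (hPi.const_smul (a := g ζ₀))]
    congr 1
    ext ζ
    simp only [smul_eq_mul]
    ring
  have hbound : ∀ ζ ∈ sphere c |R|, |fun ζ => poissonKernel c w ζ * (g ζ - g ζ₀)| ζ ≤
      ε / 2 * poissonKernel c w ζ + 2 * M * ((R ^ 2 - ‖w - c‖ ^ 2) / (δ / 2) ^ 2) := by
    intro ζ hζ
    rw [abs_of_pos hR] at hζ
    have hP0 := poissonKernel_nonneg hw hζ
    have hw2 : 0 ≤ R ^ 2 - ‖w - c‖ ^ 2 := by
      have := mem_ball_iff_norm.1 hw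
      have : ‖w - c‖ ^ 2 ≤ R ^ 2 := by gcongr
      linarith
    rw [Pi.abs_apply, abs_mul, abs_of_nonneg hP0]
    rcases lt_or_ge (dist ζ ζ₀) δ with hnear | hfar
    · have h1 : |g ζ - g ζ₀| ≤ ε / 2 := (hgδ ζ hζ hnear).le
      have h2 := mul_le_mul_of_nonneg_left h1 hP0
      have h3 : 0 ≤ 2 * M * ((R ^ 2 - ‖w - c‖ ^ 2) / (δ / 2) ^ 2) := by positivity
      linarith
    · have h1 : |g ζ - g ζ₀| ≤ 2 * M := by
        have := hM ζ hζ
        have := hM ζ₀ hζ₀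
        have := norm_sub_le (g ζ) (g ζ₀)
        rw [← Real.norm_eq_abs]
        linarith
      have h2 : δ / 2 ≤ ‖ζ - c - (w - c)‖ := by
        rw [sub_sub_sub_cancel_right, ← dist_eq_norm]
        have := dist_triangle ζ w ζ₀
        rw [mem_ball] at hwδ
        linarith
      have h3 : poissonKernel c w ζ ≤ (R ^ 2 - ‖w - c‖ ^ 2) / (δ / 2) ^ 2 := by
        rw [poissonKernel_def, mem_sphere_iff_norm.1 hζ]
        gcongr
      calc poissonKernel c w ζ * |g ζ - g ζ₀|
          ≤ (R ^ 2 - ‖w - c‖ ^ 2) / (δ / 2) ^ 2 * (2 * M) := by gcongr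
        _ ≤ _ := by nlinarith [mul_nonneg hε.le hP0]
  have hle := Real.circleAverage_mono
    (((hP.mul (hg.sub continuousOn_const)).circleIntegrable hR.le).abs)
    ((hPi.const_smul (a := ε / 2)).add (circleIntegrable_const _ c R)) hbound
  have hright : Real.circleAverage (fun ζ => ε / 2 * poissonKernel c w ζ +
      2 * M * ((R ^ 2 - ‖w - c‖ ^ 2) / (δ / 2) ^ 2)) c R =
      ε / 2 + 2 * M * ((R ^ 2 - ‖w - c‖ ^ 2) / (δ / 2) ^ 2) := by
    rw [Real.circleAverage_fun_add (f₁ := fun ζ => ε / 2 * poissonKernel c w ζ) (hPi.const_smul (a := ε / 2))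
      (circleIntegrable_const _ c R),
      Real.circleAverage_const]
    have := Real.circleAverage_fun_smul (a := ε / 2) (f := poissonKernel c w) (c := c) (R := R)
    simp only [smul_eq_mul, circleAverage_poissonKernel hw, mul_one] at this
    rw [this]
  rw [Real.dist_eq, hdiff]
  have habs := Real.abs_circleAverage_le_circleAverage_abs (c := c) (R := R)
    (f := fun ζ => poissonKernel c w ζ * (g ζ - g ζ₀))
  have := habs.trans (hle.trans_eq hright)
  linarith

/-- Solution of the **Dirichlet problem** on a disk, as the real part of an analytic function. -/
lemma exists_analyticOnNhd_ball_tendsto_re {g : ℂ → ℝ} {c : ℂ} {R : ℝ} (hR : 0 ≤ R)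
    (hg : ContinuousOn g (sphere c R)) :
    ∃ F : ℂ → ℂ, AnalyticOnNhd ℂ F (ball c R) ∧
      ∀ ζ ∈ sphere c R, Tendsto (fun w => (F w).re) (𝓝[ball c R] ζ) (𝓝 (g ζ)) := by
  have hmaps : MapsTo (fun ζ : ℂ => ζ + c) (sphere 0 R) (sphere c R) := fun ζ hζ => by
    simpa using hζ
  have hg' : ContinuousOn (fun ζ => g (ζ + c)) (sphere 0 R) := hg.comp (by fun_prop) hmaps
  have hgi : CircleIntegrable (fun ζ => g (ζ + c)) 0 R := hg'.circleIntegrable hR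
  have hgC : CircleIntegrable (fun ζ => (g (ζ + c) : ℂ)) 0 R :=
    (Complex.continuous_ofReal.comp_continuousOn hg').circleIntegrable hR
  refine ⟨fun w => Real.circleAverage
    (fun ζ => herglotzRieszKernel 0 (w - c) ζ • (g (ζ + c) : ℂ)) 0 R, fun w hw => ?_,
    fun ζ hζ => ?_⟩
  · have hw' : w - c ∈ ball 0 R := by simpa [dist_eq_norm] using hw
    exact AnalyticAt.comp (f := fun w : ℂ => w - c) (x := w)
      (analyticOnNhd_circleAverage_herglotzRieszKernel_smul hgC (w - c) hw') (by fun_prop)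
  · refine (tendsto_circleAverage_poissonKernel_mul hg hζ).congr' ?_
    filter_upwards [self_mem_nhdsWithin] with w hw
    have hw' : w - c ∈ ball 0 R := by simpa [dist_eq_norm] using hw
    rw [re_circleAverage_herglotzRieszKernel_smul hgi hw', ← Real.circleAverage_map_add_const]
    congr 1
    ext ζ
    simp [poissonKernel_eq_re_herglotzRieszKernel, herglotzRieszKernel_add_const]

/-- A continuous function on a closed disk centered on the real axis, odd under conjugation and
harmonic off the real axis, is harmonic on the open disk. -/
lemma harmonicOnNhd_ball_of_odd_conj {g : ℂ → ℝ} {c : ℂ} {R : ℝ} (hR : 0 ≤ R) (hc : c.im = 0)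
    (hg : ContinuousOn g (closedBall c R)) (hodd : ∀ z ∈ closedBall c R, g (conj z) = -g z)
    (hharm : ∀ z ∈ ball c R, z.im ≠ 0 → HarmonicAt g z) : HarmonicOnNhd g (ball c R) := by
  obtain ⟨F, hF, hFg⟩ := exists_analyticOnNhd_ball_tendsto_re hR (hg.mono sphere_subset_closedBall)
  have hcc : conj c = c := Complex.conj_eq_iff_im.2 hc
  have hdist (z : ℂ) : dist (conj z) c = dist z c := by
    conv_lhs => rw [← hcc, Complex.dist_conj_conj]
  have hball {z : ℂ} (hz : z ∈ ball c R) : conj z ∈ ball c R := by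
    rwa [mem_ball, hdist]
  let v : ℂ → ℝ := fun z => (2⁻¹ : ℝ) * ((F z).re - (F (conj z)).re)
  have hv : HarmonicOnNhd v (ball c R) := fun z hz =>
    ((hF z hz).harmonicAt_re.sub ((hF _ (hball hz)).harmonicAt_re.comp_conj)).const_smul
  have hvreal {z : ℂ} (hz : z.im = 0) : v z = 0 := by
    simp [v, Complex.conj_eq_iff_im.2 hz]
  have hvg : ∀ ζ ∈ sphere c R, Tendsto v (𝓝[ball c R] ζ) (𝓝 (g ζ)) := by
    intro ζ hζ
    have hconj : Tendsto (conj : ℂ → ℂ) (𝓝[ball c R] ζ) (𝓝[ball c R] (conj ζ)) :=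
      tendsto_nhdsWithin_iff.2 ⟨(Complex.continuous_conj.tendsto ζ).mono_left nhdsWithin_le_nhds,
        eventually_mem_nhdsWithin.mono fun z hz => hball hz⟩
    have hζ' : conj ζ ∈ sphere c R := by rwa [mem_sphere, hdist]
    have hlim := ((hFg ζ hζ).sub ((hFg _ hζ').comp hconj)).const_mul (2⁻¹ : ℝ)
    rwa [hodd ζ (sphere_subset_closedBall hζ), sub_neg_eq_add, ← two_mul,
      inv_mul_cancel_left₀ two_ne_zero] at hlim
  classical
  let D : ℂ → ℝ := (ball c R).piecewise (v - g) 0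
  have hDout : ∀ z ∉ ball c R, D z = 0 := fun z hz => piecewise_eq_of_notMem _ _ _ hz
  have hDin : ∀ z ∈ ball c R, D =ᶠ[𝓝 z] v - g := fun z hz =>
    (piecewise_eqOn _ _ _).eventuallyEq_of_mem (isOpen_ball.mem_nhds hz)
  have hDcont : Continuous D := by
    refine continuous_iff_continuousAt.2 fun z => ?_
    rcases lt_trichotomy (dist z c) R with hz | hz | hz
    · refine ContinuousAt.congr ?_ (hDin z hz).symm
      exact (hv z hz).1.continuousAt.sub
        (hg.continuousAt (mem_of_superset (isOpen_ball.mem_nhds hz) ball_subset_closedBall))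
    · have hz' : z ∉ ball c R := by simp [hz]
      have h1 : Tendsto D (𝓝[ball c R] z) (𝓝 0) := by
        have hlim := (hvg z hz).sub ((hg z (sphere_subset_closedBall hz)).mono ball_subset_closedBall)
        rw [sub_self] at hlim
        exact hlim.congr' (eventually_mem_nhdsWithin.mono fun w hw =>
          (piecewise_eq_of_mem _ _ _ hw).symm)
      have h2 : Tendsto D (𝓝[(ball c R)ᶜ] z) (𝓝 0) :=
        tendsto_const_nhds.congr' (eventually_mem_nhdsWithin.mono fun w hw => (hDout w hw).symm)
      rw [ContinuousAt, hDout z hz', ← nhdsWithin_univ, ← union_compl_self (ball c R),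
        nhdsWithin_union]
      exact h1.sup h2
    · refine ContinuousAt.congr (continuousAt_const (y := (0 : ℝ))) ?_
      filter_upwards [isClosed_closedBall.isOpen_compl.mem_nhds
        (show z ∈ (closedBall c R)ᶜ by simpa using hz)] with w hw
      exact (hDout w fun h => hw (ball_subset_closedBall h)).symm
  have hDsupp : HasCompactSupport D :=
    HasCompactSupport.intro (isCompact_closedBall c R) fun z hz =>
      hDout z fun h => hz (ball_subset_closedBall h)
  have hgreal : ∀ z ∈ ball c R, z.im = 0 → g z = 0 := fun z hz him => by
    have := hodd z (ball_subset_closedBall hz)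
    rw [Complex.conj_eq_iff_im.2 him] at this
    linarith
  have hD0 := eq_zero_of_harmonicAt_of_ne_zero hDcont hDsupp fun z hz => by
    have hzb : z ∈ ball c R := by_contra fun h => hz (hDout z h)
    have him : z.im ≠ 0 := fun him => hz <| by
      rw [(hDin z hzb).self_of_nhds, Pi.sub_apply, hvreal him, hgreal z hzb him, sub_zero]
    exact (harmonicAt_congr_nhds (hDin z hzb)).2 ((hv z hzb).sub (hharm z hzb him))
  intro z hz
  refine (harmonicAt_congr_nhds ?_).1 (hv z hz)
  filter_upwards [hDin z hz] with w hw
  rw [hD0, Pi.sub_apply] at hw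
  linarith

/-- Schwarz reflection for harmonic functions: if `U` is open and invariant
under conjugation, `u` is harmonic on `U ∩ {Im > 0}`, continuous on `U ∩ {Im ≥ 0}`, and
vanishes on `U ∩ ℝ`, then the odd reflection of `u` is harmonic on all of `U`. -/
theorem schwarz_reflection_harmonic (U : Set ℂ) (hU : IsOpen U)
    (hsym : ∀ z ∈ U, (starRingEnd ℂ) z ∈ U) (u : ℂ → ℝ)
    (hharm : HarmonicOnC u (U ∩ {z : ℂ | 0 < z.im}))
    (hcont : ContinuousOn u (U ∩ {z : ℂ | 0 ≤ z.im}))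
    (hzero : ∀ z ∈ U, z.im = 0 → u z = 0) :
    HarmonicOnC (fun z : ℂ => if 0 ≤ z.im then u z else -u ((starRingEnd ℂ) z)) U := by
  have hupper : IsOpen {z : ℂ | 0 < z.im} := isOpen_lt continuous_const Complex.continuous_im
  have hlower : IsOpen {z : ℂ | z.im < 0} := isOpen_lt Complex.continuous_im continuous_const
  rw [harmonicOnC_iff_harmonicOnNhd (hU.inter hupper)] at hharm
  rw [harmonicOnC_iff_harmonicOnNhd hU]
  set g : ℂ → ℝ := fun z : ℂ => if 0 ≤ z.im then u z else -u ((starRingEnd ℂ) z) with hgdef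
  have hoff : ∀ z ∈ U, z.im ≠ 0 → HarmonicAt g z := by
    intro z hz him
    rcases him.lt_or_gt with hneg | hpos
    · have hconj : HarmonicAt u (conj z) := hharm _ ⟨hsym z hz, by simpa using hneg⟩
      refine (harmonicAt_congr_nhds ?_).2 hconj.comp_conj.neg
      filter_upwards [hlower.mem_nhds hneg] with w hw
      exact if_neg (not_le.2 hw)
    · refine (harmonicAt_congr_nhds ?_).2 (hharm z ⟨hz, hpos⟩)
      filter_upwards [hupper.mem_nhds hpos] with w hw
      exact if_pos (le_of_lt hw)
  have hodd : ∀ z ∈ U, g (conj z) = -g z := by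
    intro z hz
    rcases lt_trichotomy z.im 0 with him | him | him
    · simp [hgdef, him.le, him.not_ge]
    · simp [hgdef, him, Complex.conj_eq_iff_im.2 him, hzero z hz him]
    · simp [hgdef, him.le, him.not_ge]
  have hgcont : ContinuousOn g U := by
    refine ContinuousOn.if (fun z hz => ?_) ?_ ?_
    · have him : z.im = 0 := by
        have := hz.2
        rwa [Complex.frontier_setOfPred_le_im] at this
      simp [Complex.conj_eq_iff_im.2 him, hzero z hz.1 him]
    · rwa [(isClosed_le continuous_const Complex.continuous_im).closure_eq]
    · simp only [not_le, Complex.closure_setOfPred_im_lt]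
      exact (hcont.comp Complex.continuous_conj.continuousOn fun z hz =>
        ⟨hsym z hz.1, by simpa using hz.2⟩).neg
  intro z hz
  by_cases him : z.im = 0
  · obtain ⟨R, hR, hball⟩ := nhds_basis_closedBall.mem_iff.1 (hU.mem_nhds hz)
    exact harmonicOnNhd_ball_of_odd_conj hR.le him (hgcont.mono hball)
      (fun w hw => hodd w (hball hw))
      (fun w hw => hoff w (hball (ball_subset_closedBall hw))) z (mem_ball_self hR)
  · exact hoff z hz him
end
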